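/- Let m be an integer, and let A = {A_1, ..., A_q} and B = {B_1, ..., B_q} be families of subsets of [n] = {1,...,n} such that A_i ≠ ∅ for all i, and A_j ⊆ B_k if and only if j = k. If |A| + m > 0 for all A ∈ A, then ∑_{i=1}^q 1 / binomial(n + m − |B_i| + |A_i|, |A_i| + m) + ∑_{X ∈ U_n(A) \ D_n(B)} (|Z_A(X)| + m) / ((|X| + m) · binomial(n + m, |X| + m)) = 1. -/

import Mathlib

open Finset

def upSet (n : ℕ) (F : Finset (Finset (Fin n))) : Finset (Finset (Fin n)) :=
  univ.filter (fun X => ∃ A ∈ F, A ⊆ X)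

def downSet (n : ℕ) (F : Finset (Finset (Fin n))) : Finset (Finset (Fin n)) :=
  univ.filter (fun X => ∃ A ∈ F, X ⊆ A)

def zSet (n : ℕ) (F : Finset (Finset (Fin n))) (X : Finset (Fin n)) : Finset (Fin n) :=
  if X ∈ upSet n F then (F.filter (fun A => A ⊆ X)).inf id else ∅

def joinFam (n : ℕ) (F G : Finset (Finset (Fin n))) : Finset (Finset (Fin n)) :=
  (F ×ˢ G).image (fun p => p.1 ∪ p.2)

noncomputable def g (a m : ℝ) (n l : ℕ) : ℝ :=
  (Nat.factorial (n - l) : ℝ) * a ^ (n - l) / ∏ k ∈ Finset.Icc l n, (a * k + m)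

theorem mem_upSet {n : ℕ} {F : Finset (Finset (Fin n))} {X : Finset (Fin n)} :
    X ∈ upSet n F ↔ ∃ A ∈ F, A ⊆ X := by
  simp [upSet]

theorem mem_downSet {n : ℕ} {F : Finset (Finset (Fin n))} {X : Finset (Fin n)} :
    X ∈ downSet n F ↔ ∃ A ∈ F, X ⊆ A := by
  simp [downSet]

theorem mem_zSet {n : ℕ} {F : Finset (Finset (Fin n))} {X : Finset (Fin n)}
    (hX : X ∈ upSet n F) {i : Fin n} : i ∈ zSet n F X ↔ ∀ A ∈ F, A ⊆ X → i ∈ A := by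
  rw [zSet, if_pos hX, Finset.mem_inf]
  simp

/-- The elements of `zSet` are the pivotal elements: those whose removal leaves the upset. -/
theorem zSet_eq_filter {n : ℕ} {F : Finset (Finset (Fin n))} {X : Finset (Fin n)}
    (hX : X ∈ upSet n F) : zSet n F X = X.filter (fun i => ¬ X.erase i ∈ upSet n F) := by
  ext i
  rw [mem_zSet hX, mem_filter, mem_upSet]
  constructor
  · intro h
    obtain ⟨A, hA, hAX⟩ := mem_upSet.1 hX
    refine ⟨hAX (h A hA hAX), ?_⟩
    rintro ⟨C, hC, hCX⟩
    exact notMem_erase i X (hCX (h C hC (hCX.trans (erase_subset _ _))))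
  · rintro ⟨-, h⟩ A hA hAX
    by_contra hi
    exact h ⟨A, hA, subset_erase.2 ⟨hAX, hi⟩⟩

/-- Double counting of the covering pairs inside an upset. -/
theorem sum_card_erase_mem_upSet {n : ℕ} (F : Finset (Finset (Fin n))) (f : ℕ → ℝ) :
    ∑ X ∈ upSet n F, ((X.filter (fun i => X.erase i ∈ upSet n F)).card : ℝ) * f X.card =
      ∑ Y ∈ upSet n F, (Yᶜ.card : ℝ) * f (Y.card + 1) := by
  simp_rw [← nsmul_eq_mul, ← sum_const]
  rw [sum_sigma', sum_sigma']
  refine sum_bij' (fun p _ => ⟨p.1.erase p.2, p.2⟩) (fun p _ => ⟨insert p.2 p.1, p.2⟩) ?_ ?_ ?_ ?_ ?_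
  · rintro ⟨X, i⟩ h
    simp only [mem_sigma, mem_filter] at h
    simp [h.2.2]
  · rintro ⟨Y, i⟩ h
    simp only [mem_sigma, mem_compl] at h
    obtain ⟨C, hC, hCY⟩ := mem_upSet.1 h.1
    simp only [mem_sigma, mem_filter, mem_insert_self, erase_insert h.2, h.1, and_true]
    exact mem_upSet.2 ⟨C, hC, hCY.trans (subset_insert _ _)⟩
  · rintro ⟨X, i⟩ h
    simp only [mem_sigma, mem_filter] at h
    simp [insert_erase h.2.1]
  · rintro ⟨Y, i⟩ h
    simp only [mem_sigma, mem_compl] at h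
    simp [erase_insert h.2]
  · rintro ⟨X, i⟩ h
    simp only [mem_sigma, mem_filter] at h
    simp [card_erase_add_one h.2.1]

/-- The value `B(k, N - k + 1)` of the beta function. -/
noncomputable def betaWeight (N k : ℕ) : ℝ := 1 / (k * N.choose k)

theorem sub_mul_betaWeight_succ {N k : ℕ} (hk : k < N) :
    ((N : ℝ) - k) * betaWeight N (k + 1) = 1 / N.choose k := by
  have h : (N.choose (k + 1) : ℝ) * (k + 1) = N.choose k * (N - k) := by
    have := Nat.choose_succ_right_eq N k
    rw [← Nat.cast_sub hk.le]
    exact_mod_cast this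
  have h1 : (0 : ℝ) < N.choose k := by exact_mod_cast Nat.choose_pos hk.le
  have h2 : (0 : ℝ) < N - k := sub_pos.2 (by exact_mod_cast hk)
  rw [betaWeight, Nat.cast_add_one, mul_comm ((k : ℝ) + 1), h]
  field_simp

theorem betaWeight_add_betaWeight_succ {N k : ℕ} (hk : 0 < k) (hkN : k ≤ N) :
    betaWeight (N + 1) k + betaWeight (N + 1) (k + 1) = betaWeight N k := by
  have h : (N + 1 : ℝ) * N.choose k = (N + 1).choose k * (N + 1 - k) := by
    have := Nat.add_one_mul_choose_eq N k
    have h' := Nat.choose_succ_right_eq (N + 1) k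
    have : (N + 1 : ℝ) * N.choose k = ((N + 1).choose k : ℝ) * ((N + 1 - k : ℕ) : ℝ) := by
      exact_mod_cast this.trans h'
    rwa [Nat.cast_sub (by lia), Nat.cast_add_one] at this
  have hs := sub_mul_betaWeight_succ (N := N + 1) (k := k) (by lia)
  have h1 : (0 : ℝ) < N.choose k := by exact_mod_cast Nat.choose_pos hkN
  have h2 : (0 : ℝ) < (N + 1).choose k := by exact_mod_cast Nat.choose_pos (by lia)
  have h3 : (0 : ℝ) < N + 1 - k := by
    have : (k : ℝ) ≤ N := by exact_mod_cast hkN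
    linarith
  have h4 : (0 : ℝ) < k := by exact_mod_cast hk
  have hb : betaWeight (N + 1) (k + 1) = 1 / ((N + 1).choose k * (N + 1 - k)) := by
    push_cast at hs
    rw [eq_div_iff (by positivity)]
    calc _ = (N + 1).choose k * (((N : ℝ) + 1 - k) * betaWeight (N + 1) (k + 1)) := by ring
      _ = 1 := by rw [hs]; field_simp
  have hc : (N.choose k : ℝ) = (N + 1).choose k * (N + 1 - k) / (N + 1) := by
    rw [← h]; field_simp
  rw [hb, betaWeight, betaWeight, hc]
  field_simp
  ring

theorem sum_powerset_betaWeight {α : Type*} [DecidableEq α] (D : Finset α) :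
    ∀ {N k : ℕ}, 0 < k → k ≤ N →
      ∑ T ∈ D.powerset, betaWeight (N + D.card) (k + T.card) = betaWeight N k := by
  induction D using Finset.induction with
  | empty => simp
  | insert a D ha ih =>
    intro N k hk hkN
    rw [sum_powerset_insert ha, card_insert_of_notMem ha, ← betaWeight_add_betaWeight_succ hk hkN,
      ← ih hk (show k ≤ N + 1 by lia), ← ih (Nat.succ_pos k) (show k + 1 ≤ N + 1 by lia)]
    congr 1
    · refine sum_congr rfl fun T _ => ?_
      congr 1; lia
    · refine sum_congr rfl fun T hT => ?_
      rw [card_insert_of_notMem fun h => ha (mem_powerset.1 hT h)]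
      congr 1 <;> lia

theorem sum_Icc_betaWeight {n : ℕ} {m : ℤ} {A B : Finset (Fin n)} (hAB : A ⊆ B)
    (hm : 0 < (A.card : ℤ) + m) :
    ∑ X ∈ Icc A B, betaWeight ((n : ℤ) + m).toNat ((X.card : ℤ) + m).toNat =
      betaWeight ((n : ℤ) + m - B.card + A.card).toNat ((A.card : ℤ) + m).toNat := by
  have hB : B.card ≤ n := by simpa using card_le_univ B
  have hc := card_sdiff_add_card_eq_card hAB
  rw [Icc_eq_image_powerset hAB, sum_image, ← sum_powerset_betaWeight (B \ A) (by lia) (by lia)]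
  · refine sum_congr rfl fun T hT => ?_
    have hd : Disjoint A T := disjoint_of_subset_right (mem_powerset.1 hT) disjoint_sdiff
    rw [card_union_of_disjoint hd]
    congr 1 <;> lia
  · intro S hS T hT h
    have hS' : Disjoint A S := disjoint_of_subset_right (mem_powerset.1 hS) disjoint_sdiff
    have hT' : Disjoint A T := disjoint_of_subset_right (mem_powerset.1 hT) disjoint_sdiff
    calc S = (A ∪ S) \ A := (union_sdiff_cancel_left hS').symm
      _ = (A ∪ T) \ A := by rw [show A ∪ S = A ∪ T from h]
      _ = T := union_sdiff_cancel_left hT'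

theorem card_add_cast_eq_toNat {α : Type*} {X : Finset α} {m : ℤ} (h : 0 < (X.card : ℤ) + m) :
    ((X.card : ℝ) + m) = (((X.card : ℤ) + m).toNat : ℝ) := by
  exact_mod_cast congrArg (Int.cast : ℤ → ℝ) (Int.toNat_of_nonneg h.le).symm

/-- The Ahlswede–Zhang identity with an integer shift. -/
theorem sum_upSet_zSet_betaWeight {n : ℕ} {m : ℤ} {F : Finset (Finset (Fin n))}
    (hF : F.Nonempty) (hm : ∀ X ∈ upSet n F, 0 < (X.card : ℤ) + m) :
    ∑ X ∈ upSet n F, (((zSet n F X).card : ℝ) + m) *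
      betaWeight ((n : ℤ) + m).toNat ((X.card : ℤ) + m).toNat = 1 := by
  set f : ℕ → ℝ := fun k => betaWeight ((n : ℤ) + m).toNat ((k : ℤ) + m).toNat with hf
  have huniv : (univ : Finset (Fin n)) ∈ upSet n F :=
    let ⟨A, hA⟩ := hF
    mem_upSet.2 ⟨A, hA, subset_univ A⟩
  have hz : ∀ X ∈ upSet n F, (((zSet n F X).card : ℝ) + m) * f X.card =
      ((X.card : ℝ) + m) * f X.card -
        ((X.filter (fun i => X.erase i ∈ upSet n F)).card : ℝ) * f X.card := by
    intro X hX
    have h := card_filter_add_card_filter_not (s := X) (fun i => X.erase i ∈ upSet n F)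
    rw [zSet_eq_filter hX, ← h]
    push_cast
    ring
  have hcast : ∀ X ∈ upSet n F, ((X.card : ℝ) + m) = (((X.card : ℤ) + m).toNat : ℝ) :=
    fun X hX => card_add_cast_eq_toNat (hm X hX)
  rw [sum_congr rfl hz, sum_sub_distrib, sum_card_erase_mem_upSet, ← sum_sub_distrib,
    sum_eq_single_of_mem univ huniv]
  · have h := hm _ huniv
    have hc := hcast _ huniv
    simp only [card_univ, Fintype.card_fin] at h hc
    have h0 : (((n : ℤ) + m).toNat : ℝ) ≠ 0 := by
      have : ((n : ℤ) + m).toNat ≠ 0 := by lia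
      exact_mod_cast this
    simp only [hf, card_univ, Fintype.card_fin, compl_univ, card_empty, hc, betaWeight,
      Nat.choose_self]
    field_simp
    simp
  · intro Y hY hne
    have hlt : Y.card < n := by simpa using card_lt_card (ssubset_univ_iff.2 hne)
    have h := hm Y hY
    set k := ((Y.card : ℤ) + m).toNat with hk
    have hk1 : (((Y.card + 1 : ℕ) : ℤ) + m).toNat = k + 1 := by lia
    have hN : ((Yᶜ.card : ℕ) : ℝ) = ((((n : ℤ) + m).toNat : ℕ) : ℝ) - k := by
      rw [card_compl, Fintype.card_fin, eq_sub_iff_add_eq]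
      have : n - Y.card + k = ((n : ℤ) + m).toNat := by lia
      exact_mod_cast this
    have h0 : (k : ℝ) ≠ 0 := by
      have : k ≠ 0 := by lia
      exact_mod_cast this
    simp only [hf]
    rw [hk1, hN, sub_mul_betaWeight_succ (by lia), hcast Y hY, ← hk, betaWeight]
    field_simp
    simp

/-- Thu's generalization of the Ahlswede–Cai identity with an integer shift m. -/
theorem ahlswede_cai_identity_shifted (n q : ℕ) (hq : 0 < q) (m : ℤ)
    (A B : Fin q → Finset (Fin n))
    (hA : ∀ i, A i ≠ ∅)
    (hAB : ∀ j k, A j ⊆ B k ↔ j = k)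
    (hm : ∀ i, 0 < ((A i).card : ℤ) + m) :
    ∑ i, (1 : ℝ) /
        (Nat.choose ((n : ℤ) + m - (B i).card + (A i).card).toNat (((A i).card : ℤ) + m).toNat)
      + ∑ X ∈ upSet n (Finset.univ.image A) \ downSet n (Finset.univ.image B),
          (((zSet n (Finset.univ.image A) X).card : ℝ) + m) /
            (((X.card : ℝ) + m) * (Nat.choose ((n : ℤ) + m).toNat ((X.card : ℤ) + m).toNat))
      = 1 := by
  classical
  set F := Finset.univ.image A with hF
  set G := Finset.univ.image B with hG
  set w : Finset (Fin n) → ℝ :=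
    fun X => betaWeight ((n : ℤ) + m).toNat ((X.card : ℤ) + m).toNat with hw
  have hpos : ∀ X ∈ upSet n F, 0 < (X.card : ℤ) + m := by
    intro X hX
    obtain ⟨C, hC, hCX⟩ := mem_upSet.1 hX
    obtain ⟨i, -, rfl⟩ := mem_image.1 hC
    have := card_le_card hCX
    have := hm i
    lia
  have hinter : upSet n F ∩ downSet n G = univ.biUnion fun i => Icc (A i) (B i) := by
    ext X
    simp only [mem_inter, mem_upSet, mem_downSet, hF, hG, mem_image, mem_univ, true_and,
      exists_exists_eq_and, mem_biUnion, mem_Icc]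
    constructor
    · rintro ⟨⟨i, hi⟩, ⟨j, hj⟩⟩
      obtain rfl := (hAB i j).1 (hi.trans hj)
      exact ⟨i, hi, hj⟩
    · rintro ⟨i, hi, hj⟩
      exact ⟨⟨i, hi⟩, ⟨i, hj⟩⟩
  have hzA : ∀ i, ∀ X ∈ Icc (A i) (B i), zSet n F X = A i := by
    intro i X hX
    obtain ⟨hAX, hXB⟩ := mem_Icc.1 hX
    have hU : X ∈ upSet n F := mem_upSet.2 ⟨A i, mem_image_of_mem _ (mem_univ i), hAX⟩
    ext x
    rw [mem_zSet hU]
    refine ⟨fun h => h _ (mem_image_of_mem _ (mem_univ i)) hAX, fun hx C hC hCX => ?_⟩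
    obtain ⟨j, -, rfl⟩ := mem_image.1 hC
    rwa [(hAB j i).1 (hCX.trans hXB)]
  have hdisj : (↑(univ : Finset (Fin q)) : Set (Fin q)).PairwiseDisjoint
      fun i => Icc (A i) (B i) := by
    intro i _ j _ hij
    refine disjoint_left.2 fun X hi hj => hij ((hAB i j).1 ?_)
    exact (mem_Icc.1 hi).1.trans (mem_Icc.1 hj).2
  have hfirst : ∑ i, (1 : ℝ) / (Nat.choose ((n : ℤ) + m - (B i).card + (A i).card).toNat
      (((A i).card : ℤ) + m).toNat) =
      ∑ X ∈ upSet n F ∩ downSet n G, (((zSet n F X).card : ℝ) + m) * w X := by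
    rw [hinter, sum_biUnion hdisj]
    refine sum_congr rfl fun i _ => ?_
    rw [sum_congr rfl fun X hX => by rw [hzA i X hX], ← mul_sum, hw,
      sum_Icc_betaWeight ((hAB i i).2 rfl) (hm i), card_add_cast_eq_toNat (hm i), betaWeight]
    have h0 : ((((A i).card : ℤ) + m).toNat : ℝ) ≠ 0 := by
      have : (((A i).card : ℤ) + m).toNat ≠ 0 := by have := hm i; lia
      exact_mod_cast this
    field_simp
  have hsecond : ∑ X ∈ upSet n F \ downSet n G, (((zSet n F X).card : ℝ) + m) /
      (((X.card : ℝ) + m) * (Nat.choose ((n : ℤ) + m).toNat ((X.card : ℤ) + m).toNat)) =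
      ∑ X ∈ upSet n F \ downSet n G, (((zSet n F X).card : ℝ) + m) * w X := by
    refine sum_congr rfl fun X hX => ?_
    simp only [card_add_cast_eq_toNat (hpos X (mem_sdiff.1 hX).1), hw, betaWeight, mul_one_div]
  rw [hfirst, hsecond, sum_inter_add_sum_sdiff]
  exact sum_upSet_zSet_betaWeight ⟨_, mem_image_of_mem A (mem_univ ⟨0, hq⟩)⟩ hpos
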